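/- Let c, d ≥ 1 be integers and let (f_n)_{n∈ℕ} be a family of Boolean functions f_n : {0,1}^n × {0,1}^n → {0,1}. If there is a polynomial p with GH_{ε(n)}(f_n) ≤ p(n) for all n, where ε(n) = 1/2 − n^{−c}, then there is a polynomial q with GH_{2^{−n^d}}(f_n) ≤ q(n) for all n (error amplification for randomized garden-hose protocols). -/

import Mathlib

/-- A partial matching on the vertex type `V`, encoded by a partner function:
`m i = some j` means that there is an edge between `i` and `j`;
the graph `{ {i,j} | m i = some j }` then has maximum degree at most `1`
and no self-loops. -/
def IsPartialMatching {V : Type*} (m : V → Option V) : Prop :=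
  ∀ i j, m i = some j → i ≠ j ∧ m j = some i

/-- The position of the water in a garden-hose game with `s` pipes:
`atAlice i` (resp. `atBob i`) means the water has just arrived at Alice's
(resp. Bob's) end of pipe `i`; `exitA` / `exitB` mean the water has exited
on Alice's / Bob's side, i.e. the maximal path starting at the tap has ended
in `A∘` / in `B`. -/
inductive GHState (s : ℕ) where
  | atAlice : Fin s → GHState s
  | atBob : Fin s → GHState s
  | exitA : GHState s
  | exitB : GHState s
  deriving DecidableEq

/-- Vertex `k` of `A∘ = {0, 1, ..., s}` viewed as a pipe: vertex `0` is the water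
tap (no pipe), and vertex `i + 1` is Alice's end of pipe `i`. -/
def toPipe {s : ℕ} (k : Fin (s + 1)) : Option (Fin s) :=
  if h : (k : ℕ) = 0 then none
  else some ⟨(k : ℕ) - 1, by have := k.isLt; omega⟩

/-- One step of the water flow, given Alice's connections `a` on `A∘ = {0,...,s}`
and Bob's connections `b` on `B = {1,...,s}` (indexed by pipes `Fin s`). -/
def ghStep {s : ℕ} (a : Fin (s + 1) → Option (Fin (s + 1)))
    (b : Fin s → Option (Fin s)) : GHState s → GHState s
  | GHState.atAlice i =>
    match a i.succ with
    | none => GHState.exitA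
    | some k =>
      match toPipe k with
      | none => GHState.exitA
      | some p => GHState.atBob p
  | GHState.atBob i =>
    match b i with
    | none => GHState.exitB
    | some j => GHState.atAlice j
  | GHState.exitA => GHState.exitA
  | GHState.exitB => GHState.exitB

/-- The start of the water flow: the tap (vertex `0` of `A∘`) is connected by
Alice to at most one pipe. -/
def ghStart {s : ℕ} (a : Fin (s + 1) → Option (Fin (s + 1))) : GHState s :=
  match a 0 with
  | none => GHState.exitA
  | some k =>
    match toPipe k with
    | none => GHState.exitA
    | some p => GHState.atBob p

/-- The endpoint of the maximal path `π(x,y)` starting at the tap: since the graph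
has maximum degree `2` and the path is simple, it is reached after at most
`2s + 2` steps. -/
def ghResult {s : ℕ} (a : Fin (s + 1) → Option (Fin (s + 1)))
    (b : Fin s → Option (Fin s)) : GHState s :=
  (ghStep a b)^[2 * s + 2] (ghStart a)

/-- A garden-hose game of size `s` on inputs `{0,1}^n × {0,1}^n`: for every input
`x` Alice chooses a partial matching `EA x` on `A∘ = {0,1,…,s}` and for every
input `y` Bob chooses a partial matching `EB y` on `B = {1,…,s}`. -/
structure GHGame (n s : ℕ) where
  EA : (Fin n → Bool) → Fin (s + 1) → Option (Fin (s + 1))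
  EB : (Fin n → Bool) → Fin s → Option (Fin s)
  matchA : ∀ x, IsPartialMatching (EA x)
  matchB : ∀ y, IsPartialMatching (EB y)

/-- Where the water exits on input `(x, y)`. -/
def GHGame.run {n s : ℕ} (G : GHGame n s) (x y : Fin n → Bool) : GHState s :=
  ghResult (G.EA x) (G.EB y)

/-- The game `G` computes `f` if for all inputs the maximal path from the tap ends
in `A∘` whenever `f x y = 0` (water exits on Alice's side) and in `B` whenever
`f x y = 1` (water exits on Bob's side). -/
def GHGame.Computes {n s : ℕ} (G : GHGame n s)
    (f : (Fin n → Bool) → (Fin n → Bool) → Bool) : Prop :=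
  ∀ x y, G.run x y = if f x y then GHState.exitB else GHState.exitA

/-- The garden-hose complexity of `f`: the minimal number of pipes of a
garden-hose game computing `f`. -/
noncomputable def GH {n : ℕ} (f : (Fin n → Bool) → (Fin n → Bool) → Bool) : ℕ :=
  sInf {s : ℕ | ∃ G : GHGame n s, G.Computes f}
/-- A randomized garden-hose protocol of size `s` for `f` with error `ε`:
a finite set (indexed by `Fin k`) equipped with a probability distribution
`prob` and, for each random string `r`, a garden-hose game `game r` of size `s`
such that for every input `(x, y)` the probability over `r` that `game r`
computes the value `f x y` at `(x, y)` is at least `1 - ε`. -/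
structure RandGHProtocol (n s : ℕ) (f : (Fin n → Bool) → (Fin n → Bool) → Bool)
    (ε : ℝ) where
  k : ℕ
  prob : Fin k → ℝ
  prob_nonneg : ∀ r, 0 ≤ prob r
  prob_sum : ∑ r, prob r = 1
  game : Fin k → GHGame n s
  correct : ∀ x y, 1 - ε ≤ ∑ r,
    if (game r).run x y = (if f x y then GHState.exitB else GHState.exitA)
    then prob r else 0

/-- The randomized garden-hose complexity `GH_ε(f)`: the minimal size of a
randomized garden-hose protocol for `f` with error `ε`. -/
noncomputable def GHr {n : ℕ} (ε : ℝ)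
    (f : (Fin n → Bool) → (Fin n → Bool) → Bool) : ℕ :=
  sInf {s : ℕ | Nonempty (RandGHProtocol n s f ε)}


namespace GHAmp

open Relation

/-- States of the water flow on an abstract pipe type. -/
inductive St (P : Type) where
  | A : Option P → St P
  | B : P → St P

/-- One step of the flow. -/
inductive Stp {P : Type} (a : Option P → Option (Option P)) (b : P → Option P) :
    St P → St P → Prop
  | ab (v : Option P) (p : P) (h : a v = some (some p)) : Stp a b (St.A v) (St.B p)
  | ba (p q : P) (h : b p = some q) : Stp a b (St.B p) (St.A (some q))

/-- The flow from the tap ends with value `c`. -/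
def Out {P : Type} (a : Option P → Option (Option P)) (b : P → Option P) (c : Bool) : Prop :=
  match c with
  | false => ∃ v, ReflTransGen (Stp a b) (St.A none) (St.A v) ∧ a v = none
  | true => ∃ p, ReflTransGen (Stp a b) (St.A none) (St.B p) ∧ b p = none

/-! ### Composition -/

/-- Pipes of the composed game. -/
inductive CP (F G H : Type) where
  | m : F → CP F G H
  | z : Option F → CP F G H
  | o : Option F → CP F G H
  | g : Option G → CP F G H
  | h : Option H → CP F G H

def cpEquiv (F G H : Type) :
    CP F G H ≃ F ⊕ Option F ⊕ Option F ⊕ Option G ⊕ Option H where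
  toFun
    | .m p => .inl p
    | .z v => .inr (.inl v)
    | .o v => .inr (.inr (.inl v))
    | .g v => .inr (.inr (.inr (.inl v)))
    | .h v => .inr (.inr (.inr (.inr v)))
  invFun
    | .inl p => .m p
    | .inr (.inl v) => .z v
    | .inr (.inr (.inl v)) => .o v
    | .inr (.inr (.inr (.inl v))) => .g v
    | .inr (.inr (.inr (.inr v))) => .h v
  left_inv := by rintro (_ | _ | _ | _ | _) <;> rfl
  right_inv := by rintro (_ | _ | _ | _ | _) <;> rfl

section comp
variable {F G H : Type}

def compM (aF : Option F → Option (Option F)) (v : Option F) : Option (Option (CP F G H)) :=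
  match aF v with
  | some w => some (w.map CP.m)
  | none => some (some (CP.z v))

def compA (aF : Option F → Option (Option F)) (aG : Option G → Option (Option G))
    (aH : Option H → Option (Option H)) : Option (CP F G H) → Option (Option (CP F G H))
  | none => compM aF none
  | some (.m p) => compM aF (some p)
  | some (.z v) =>
    match aF v with
    | some w => some (some (.z w))
    | none => some (v.map CP.m)
  | some (.o v) => (aF v).map (fun w => some (.o w))
  | some (.g v) => (aG v).map (fun w => some (.g w))
  | some (.h v) => (aH v).map (fun w => some (.h w))

def compB (bF : F → Option F) (bG : G → Option G) (bH : H → Option H) :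
    CP F G H → Option (CP F G H)
  | .m p =>
    match bF p with
    | some q => some (.m q)
    | none => some (.o (some p))
  | .z none => some (.h none)
  | .z (some p) => (bF p).map (fun q => .z (some q))
  | .o none => some (.g none)
  | .o (some p) =>
    match bF p with
    | some q => some (.o (some q))
    | none => some (.m p)
  | .g none => some (.o none)
  | .g (some p) => (bG p).map (fun q => .g (some q))
  | .h none => some (.z none)
  | .h (some p) => (bH p).map (fun q => .h (some q))

variable {aF : Option F → Option (Option F)} {aG : Option G → Option (Option G)}
  {aH : Option H → Option (Option H)} {bF : F → Option F} {bG : G → Option G}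
  {bH : H → Option H}

theorem compA_map (v : Option F) :
    compA aF aG aH (v.map CP.m) = compM aF v := by
  cases v <;> rfl

theorem compA_matching (hF : IsPartialMatching aF) (hG : IsPartialMatching aG)
    (hH : IsPartialMatching aH) : IsPartialMatching (compA aF aG aH) := by
  have key : ∀ v : Option F, ∀ j, compM (G := G) (H := H) aF v = some j →
      v.map CP.m ≠ j ∧ compA aF aG aH j = some (v.map CP.m) := by
    intro v j hj
    unfold compM at hj
    cases hv : aF v with
    | none =>
      simp only [hv, Option.some.injEq] at hj
      subst hj
      refine ⟨by cases v <;> simp, by simp [compA, hv]⟩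
    | some w =>
      simp only [hv, Option.some.injEq] at hj
      subst hj
      obtain ⟨h1, h2⟩ := hF _ _ hv
      refine ⟨?_, by rw [compA_map]; simp [compM, h2]⟩
      cases v <;> cases w <;> simp_all
  rintro (_ | p | v | v | v | v) j hj
  · exact key none j hj
  · exact key (some p) j hj
  · cases hv : aF v with
    | none =>
      simp only [compA, hv, Option.some.injEq] at hj
      subst hj
      refine ⟨by cases v <;> simp, by rw [compA_map]; simp [compM, hv]⟩
    | some w =>
      simp only [compA, hv, Option.some.injEq] at hj
      subst hj
      obtain ⟨h1, h2⟩ := hF _ _ hv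
      refine ⟨by simpa using h1, by simp [compA, h2]⟩
  · simp only [compA, Option.map_eq_some_iff] at hj
    obtain ⟨w, hw, rfl⟩ := hj
    obtain ⟨h1, h2⟩ := hF _ _ hw
    exact ⟨by simpa using h1, by simp [compA, h2]⟩
  · simp only [compA, Option.map_eq_some_iff] at hj
    obtain ⟨w, hw, rfl⟩ := hj
    obtain ⟨h1, h2⟩ := hG _ _ hw
    exact ⟨by simpa using h1, by simp [compA, h2]⟩
  · simp only [compA, Option.map_eq_some_iff] at hj
    obtain ⟨w, hw, rfl⟩ := hj
    obtain ⟨h1, h2⟩ := hH _ _ hw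
    exact ⟨by simpa using h1, by simp [compA, h2]⟩

theorem compB_matching (hF : IsPartialMatching bF) (hG : IsPartialMatching bG)
    (hH : IsPartialMatching bH) : IsPartialMatching (compB bF bG bH) := by
  rintro (p | (_ | p) | (_ | p) | (_ | p) | (_ | p)) j hj
  · cases hv : bF p with
    | none =>
      simp only [compB, hv, Option.some.injEq] at hj
      subst hj
      exact ⟨by simp, by simp [compB, hv]⟩
    | some w =>
      simp only [compB, hv, Option.some.injEq] at hj
      subst hj
      obtain ⟨h1, h2⟩ := hF _ _ hv
      exact ⟨by simpa using h1, by simp [compB, h2]⟩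
  · simp only [compB, Option.some.injEq] at hj
    subst hj
    exact ⟨by simp, by simp [compB]⟩
  · simp only [compB, Option.map_eq_some_iff] at hj
    obtain ⟨w, hw, rfl⟩ := hj
    obtain ⟨h1, h2⟩ := hF _ _ hw
    exact ⟨by simpa using h1, by simp [compB, h2]⟩
  · simp only [compB, Option.some.injEq] at hj
    subst hj
    exact ⟨by simp, by simp [compB]⟩
  · cases hv : bF p with
    | none =>
      simp only [compB, hv, Option.some.injEq] at hj
      subst hj
      exact ⟨by simp, by simp [compB, hv]⟩
    | some w =>
      simp only [compB, hv, Option.some.injEq] at hj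
      subst hj
      obtain ⟨h1, h2⟩ := hF _ _ hv
      exact ⟨by simpa using h1, by simp [compB, h2]⟩
  · simp only [compB, Option.some.injEq] at hj
    subst hj
    exact ⟨by simp, by simp [compB]⟩
  · simp only [compB, Option.map_eq_some_iff] at hj
    obtain ⟨w, hw, rfl⟩ := hj
    obtain ⟨h1, h2⟩ := hG _ _ hw
    exact ⟨by simpa using h1, by simp [compB, h2]⟩
  · simp only [compB, Option.some.injEq] at hj
    subst hj
    exact ⟨by simp, by simp [compB]⟩
  · simp only [compB, Option.map_eq_some_iff] at hj
    obtain ⟨w, hw, rfl⟩ := hj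
    obtain ⟨h1, h2⟩ := hH _ _ hw
    exact ⟨by simpa using h1, by simp [compB, h2]⟩

def liftM : St F → St (CP F G H)
  | .A v => .A (v.map CP.m)
  | .B p => .B (.m p)

/-- The reversed states in copy `z`. -/
def revZ : St F → St (CP F G H)
  | .A v => .B (.z v)
  | .B p => .A (some (.z (some p)))

def revO : St F → St (CP F G H)
  | .A v => .B (.o v)
  | .B p => .A (some (.o (some p)))

def liftG : St G → St (CP F G H)
  | .A v => .A (some (.g v))
  | .B p => .B (.g (some p))

def liftH : St H → St (CP F G H)
  | .A v => .A (some (.h v))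
  | .B p => .B (.h (some p))

theorem liftM_step {σ τ : St F} (h : Stp aF bF σ τ) :
    Stp (compA aF aG aH) (compB bF bG bH) (liftM σ) (liftM τ) := by
  cases h with
  | ab v p h => exact .ab _ _ (by rw [compA_map]; simp [compM, h])
  | ba p q h => exact .ba _ _ (by simp [compB, h])

theorem liftG_step {σ τ : St G} (h : Stp aG bG σ τ) :
    Stp (compA aF aG aH) (compB bF bG bH) (liftG σ) (liftG τ) := by
  cases h with
  | ab v p h => exact .ab _ _ (by simp [compA, h])
  | ba p q h => exact .ba _ _ (by simp [compB, h])

theorem liftH_step {σ τ : St H} (h : Stp aH bH σ τ) :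
    Stp (compA aF aG aH) (compB bF bG bH) (liftH σ) (liftH τ) := by
  cases h with
  | ab v p h => exact .ab _ _ (by simp [compA, h])
  | ba p q h => exact .ba _ _ (by simp [compB, h])

theorem revZ_step (hA : IsPartialMatching aF) (hB : IsPartialMatching bF)
    {σ τ : St F} (h : Stp aF bF σ τ) :
    Stp (compA aF aG aH) (compB bF bG bH) (revZ τ) (revZ σ) := by
  cases h with
  | ab v p h => exact .ab _ _ (by simp [compA, (hA _ _ h).2])
  | ba p q h => exact .ba _ _ (by simp [compB, (hB _ _ h).2])

theorem revO_step (hA : IsPartialMatching aF) (hB : IsPartialMatching bF)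
    {σ τ : St F} (h : Stp aF bF σ τ) :
    Stp (compA aF aG aH) (compB bF bG bH) (revO τ) (revO σ) := by
  cases h with
  | ab v p h => exact .ab _ _ (by simp [compA, (hA _ _ h).2])
  | ba p q h => exact .ba _ _ (by simp [compB, (hB _ _ h).2])

theorem rev_reach {S T : Type} {r : S → S → Prop} {r' : T → T → Prop} {φ : S → T}
    (hφ : ∀ σ τ, r σ τ → r' (φ τ) (φ σ)) {σ τ : S} (h : ReflTransGen r σ τ) :
    ReflTransGen r' (φ τ) (φ σ) := by
  induction h with
  | refl => exact .refl
  | tail _ h ih => exact .head (hφ _ _ h) ih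

theorem fwd_reach {S T : Type} {r : S → S → Prop} {r' : T → T → Prop} {φ : S → T}
    (hφ : ∀ σ τ, r σ τ → r' (φ σ) (φ τ)) {σ τ : S} (h : ReflTransGen r σ τ) :
    ReflTransGen r' (φ σ) (φ τ) := by
  induction h with
  | refl => exact .refl
  | tail _ h ih => exact .tail ih (hφ _ _ h)

theorem comp_out (hA : IsPartialMatching aF) (hB : IsPartialMatching bF) {u v w : Bool}
    (hF : Out aF bF u) (hG : Out aG bG v) (hH : Out aH bH w) :
    Out (compA aF aG aH) (compB bF bG bH) (if u then v else w) := by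
  cases u with
  | false =>
    obtain ⟨i, hi, hi0⟩ := hF
    have h1 : ReflTransGen (Stp (compA aF aG aH) (compB bF bG bH)) (.A none)
        (.A (i.map CP.m)) := fwd_reach (φ := liftM) (fun _ _ h => liftM_step h) hi
    have h2 := h1.tail (.ab _ (.z i) (by rw [compA_map]; simp [compM, hi0]))
    have h3 : ReflTransGen (Stp (compA aF aG aH) (compB bF bG bH)) (.B (.z i)) (.B (.z none)) :=
      rev_reach (φ := revZ) (fun _ _ h => revZ_step hA hB h) hi
    have h4 := (h2.trans h3).tail (.ba _ (.h none) (by simp [compB]))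
    cases w with
    | false =>
      obtain ⟨j, hj, hj0⟩ := hH
      exact ⟨some (.h j), h4.trans (fwd_reach (φ := liftH) (fun _ _ h => liftH_step h) hj),
        by simp [compA, hj0]⟩
    | true =>
      obtain ⟨j, hj, hj0⟩ := hH
      exact ⟨.h (some j), h4.trans (fwd_reach (φ := liftH) (fun _ _ h => liftH_step h) hj),
        by simp [compB, hj0]⟩
  | true =>
    obtain ⟨i, hi, hi0⟩ := hF
    have h1 : ReflTransGen (Stp (compA aF aG aH) (compB bF bG bH)) (.A none)
        (.B (.m i)) := fwd_reach (φ := liftM) (fun _ _ h => liftM_step h) hi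
    have h2 := h1.tail (.ba _ (.o (some i)) (by simp [compB, hi0]))
    have h3 : ReflTransGen (Stp (compA aF aG aH) (compB bF bG bH)) (.A (some (.o (some i))))
        (.B (.o none)) :=
      rev_reach (φ := revO) (fun _ _ h => revO_step hA hB h) hi
    have h4 := (h2.trans h3).tail (.ba _ (.g none) (by simp [compB]))
    cases v with
    | false =>
      obtain ⟨j, hj, hj0⟩ := hG
      exact ⟨some (.g j), h4.trans (fwd_reach (φ := liftG) (fun _ _ h => liftG_step h) hj),
        by simp [compA, hj0]⟩
    | true =>
      obtain ⟨j, hj, hj0⟩ := hG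
      exact ⟨.g (some j), h4.trans (fwd_reach (φ := liftG) (fun _ _ h => liftG_step h) hj),
        by simp [compB, hj0]⟩

end comp

/-! ### The flow never returns to the tap -/

def rev {P : Type} : St P → Option (St P)
  | .A none => none
  | .A (some p) => some (.B p)
  | .B p => some (.A (some p))

/-- Walks of a given length. -/
inductive Walk {S : Type} (r : S → S → Prop) : ℕ → S → S → Prop
  | nil (σ : S) : Walk r 0 σ σ
  | one {σ τ : S} (h : r σ τ) : Walk r 1 σ τ
  | two {n : ℕ} {σ σ' τ' τ : S} (h : r σ σ') (w : Walk r n σ' τ') (h' : r τ' τ) :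
      Walk r (n + 2) σ τ

theorem Walk.snoc {S : Type} {r : S → S → Prop} {n : ℕ} {σ τ υ : S} (w : Walk r n σ τ)
    (h : r τ υ) : Walk r (n + 1) σ υ := by
  induction w generalizing υ with
  | nil σ => exact .one h
  | one h1 => exact .two h1 (.nil _) h
  | two h1 w h2 ih => exact .two h1 (ih h2) h

theorem walk_of_reach {S : Type} {r : S → S → Prop} {σ τ : S} (h : ReflTransGen r σ τ) :
    ∃ n, Walk r n σ τ := by
  induction h with
  | refl => exact ⟨0, .nil _⟩
  | tail _ h ih => obtain ⟨n, w⟩ := ih; exact ⟨_, w.snoc h⟩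

theorem walk_ne_rev {P : Type} {a : Option P → Option (Option P)} {b : P → Option P}
    (ha : IsPartialMatching a) (hb : IsPartialMatching b) {n : ℕ} {σ τ : St P}
    (w : Walk (Stp a b) n σ τ) : rev σ ≠ some τ := by
  induction w with
  | nil σ => rcases σ with (_ | p) | p <;> simp [rev]
  | one h =>
    cases h with
    | ab v p h =>
      have := (ha _ _ h).1
      cases v <;> simp_all [rev]
    | ba p q h =>
      have := (hb _ _ h).1
      simp_all [rev]
  | two h w h' ih =>
    intro hr
    apply ih
    cases h with
    | ab v p h =>
      cases h' with
      | ab v' p' h' =>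
        cases v with
        | none => simp [rev] at hr
        | some v =>
          simp only [rev, Option.some.injEq, St.B.injEq] at hr
          subst hr
          have := (ha _ _ h').2
          simp_all [rev]
      | ba p' q' h' => cases v <;> simp [rev] at hr
    | ba p q h =>
      cases h' with
      | ab v' p' h' => simp [rev] at hr
      | ba p' q' h' =>
        simp only [rev, Option.some.injEq, St.A.injEq] at hr
        subst hr
        have := (hb _ _ h').2
        simp_all [rev]

theorem not_return {P : Type} {a : Option P → Option (Option P)} {b : P → Option P}
    (ha : IsPartialMatching a) (hb : IsPartialMatching b) {v : Option P}
    (h : ReflTransGen (Stp a b) (St.A none) (St.A v)) : a v ≠ some none := by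
  intro hv
  obtain ⟨h1, h2⟩ := ha _ _ hv
  rcases h.cases_head with h3 | ⟨σ, h3, h4⟩
  · simp only [St.A.injEq] at h3; exact h1 h3.symm
  · cases h3 with
    | ab _ p h3 =>
      obtain ⟨n, w⟩ := walk_of_reach h4
      apply walk_ne_rev ha hb w
      simp_all [rev]

/-! ### Transport to `Fin` and totality -/

theorem toPipe_zero {s : ℕ} : toPipe (0 : Fin (s + 1)) = none := by simp [toPipe]

theorem toPipe_succ {s : ℕ} (i : Fin s) : toPipe i.succ = some i := by simp [toPipe]

section fin
variable {s : ℕ} {P : Type}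

def hat (e : P ≃ Fin s) : Option P ≃ Fin (s + 1) :=
  (Equiv.optionCongr e).trans (finSuccEquiv s).symm

@[simp] theorem hat_none (e : P ≃ Fin s) : hat e none = 0 := by simp [hat]
@[simp] theorem hat_some (e : P ≃ Fin s) (p : P) : hat e (some p) = (e p).succ := by simp [hat]
@[simp] theorem hat_symm_zero (e : P ≃ Fin s) : (hat e).symm 0 = none := by
  rw [Equiv.symm_apply_eq]; simp
@[simp] theorem hat_symm_succ (e : P ≃ Fin s) (i : Fin s) :
    (hat e).symm i.succ = some (e.symm i) := by
  rw [Equiv.symm_apply_eq]; simp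

def finA (e : P ≃ Fin s) (a : Option P → Option (Option P)) (k : Fin (s + 1)) :
    Option (Fin (s + 1)) := (a ((hat e).symm k)).map (hat e)

def finB (e : P ≃ Fin s) (b : P → Option P) (k : Fin s) : Option (Fin s) :=
  (b (e.symm k)).map e

def unA (a : Fin (s + 1) → Option (Fin (s + 1))) (v : Option (Fin s)) :
    Option (Option (Fin s)) :=
  (a (hat (Equiv.refl _) v)).map (hat (Equiv.refl _)).symm

theorem conj_matching {V W : Type} (e : V ≃ W) {m : V → Option V} (hm : IsPartialMatching m) :
    IsPartialMatching (fun w => (m (e.symm w)).map e) := by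
  intro i j hij
  simp only [Option.map_eq_some_iff] at hij
  obtain ⟨v, hv, rfl⟩ := hij
  obtain ⟨h1, h2⟩ := hm _ _ hv
  refine ⟨?_, by simp [h2]⟩
  rintro rfl
  simp at h1

theorem step_exitA (a : Fin (s + 1) → Option (Fin (s + 1))) (b : Fin s → Option (Fin s)) (N : ℕ) :
    (ghStep a b)^[N] GHState.exitA = GHState.exitA :=
  Function.iterate_fixed rfl N

theorem step_exitB (a : Fin (s + 1) → Option (Fin (s + 1))) (b : Fin s → Option (Fin s)) (N : ℕ) :
    (ghStep a b)^[N] GHState.exitB = GHState.exitB :=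
  Function.iterate_fixed rfl N

/-- Non-exit states. -/
def pos : GHState s → Option (Fin s ⊕ Fin s)
  | .atAlice i => some (.inl i)
  | .atBob i => some (.inr i)
  | _ => none

theorem pos_inj {σ τ : GHState s} (h : pos σ = pos τ) (hσ : pos σ ≠ none) : σ = τ := by
  cases σ <;> cases τ <;> simp_all [pos]

theorem step_pos {a : Fin (s + 1) → Option (Fin (s + 1))} {b : Fin s → Option (Fin s)}
    {σ : GHState s} (h : pos (ghStep a b σ) ≠ none) : pos σ ≠ none := by
  cases σ <;> simp_all [pos, ghStep]

theorem step_atBob {a : Fin (s + 1) → Option (Fin (s + 1))} {b : Fin s → Option (Fin s)}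
    {σ : GHState s} {j : Fin s} (h : ghStep a b σ = .atBob j) :
    ∃ i, σ = .atAlice i ∧ a i.succ = some j.succ := by
  cases σ with
  | atAlice i =>
    refine ⟨i, rfl, ?_⟩
    cases hk : a i.succ with
    | none => simp [ghStep, hk] at h
    | some k =>
      induction k using Fin.cases with
      | zero => simp [ghStep, hk, toPipe_zero] at h
      | succ k => simp [ghStep, hk, toPipe_succ] at h; simp [h]
  | atBob i => cases hk : b i <;> simp [ghStep, hk] at h
  | exitA => simp [ghStep] at h
  | exitB => simp [ghStep] at h

theorem step_atAlice {a : Fin (s + 1) → Option (Fin (s + 1))} {b : Fin s → Option (Fin s)}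
    {σ : GHState s} {j : Fin s} (h : ghStep a b σ = .atAlice j) :
    ∃ i, σ = .atBob i ∧ b i = some j := by
  cases σ with
  | atAlice i =>
    cases hk : a i.succ with
    | none => simp [ghStep, hk] at h
    | some k =>
      induction k using Fin.cases with
      | zero => simp [ghStep, hk, toPipe_zero] at h
      | succ k => simp [ghStep, hk, toPipe_succ] at h
  | atBob i =>
    refine ⟨i, rfl, ?_⟩
    cases hk : b i <;> simp [ghStep, hk] at h
    simp [h]
  | exitA => simp [ghStep] at h
  | exitB => simp [ghStep] at h

theorem step_inj {a : Fin (s + 1) → Option (Fin (s + 1))} {b : Fin s → Option (Fin s)}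
    (ha : IsPartialMatching a) (hb : IsPartialMatching b)
    {σ τ : GHState s} (h : ghStep a b σ = ghStep a b τ) (hσ : pos (ghStep a b σ) ≠ none) :
    σ = τ := by
  cases hs : ghStep a b σ with
  | atAlice j =>
    obtain ⟨i, rfl, hi⟩ := step_atAlice hs
    obtain ⟨i', rfl, hi'⟩ := step_atAlice (h ▸ hs)
    have h1 := (hb _ _ hi).2
    have h2 := (hb _ _ hi').2
    simp_all
  | atBob j =>
    obtain ⟨i, rfl, hi⟩ := step_atBob hs
    obtain ⟨i', rfl, hi'⟩ := step_atBob (h ▸ hs)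
    have h1 := (ha _ _ hi).2
    have h2 := (ha _ _ hi').2
    simp_all
  | exitA => simp [hs, pos] at hσ
  | exitB => simp [hs, pos] at hσ

theorem start_cases (a : Fin (s + 1) → Option (Fin (s + 1))) :
    ghStart a = .exitA ∨ ∃ p : Fin s, a 0 = some p.succ ∧ ghStart a = .atBob p := by
  cases hk : a 0 with
  | none => simp [ghStart, hk]
  | some k =>
    induction k using Fin.cases with
    | zero => simp [ghStart, hk, toPipe_zero]
    | succ k => simp [ghStart, hk, toPipe_succ]

theorem no_repeat {a : Fin (s + 1) → Option (Fin (s + 1))} {b : Fin s → Option (Fin s)}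
    (ha : IsPartialMatching a) (hb : IsPartialMatching b) (d i : ℕ)
    (h : (ghStep a b)^[i] (ghStart a) = (ghStep a b)^[i + d + 1] (ghStart a))
    (hp : pos ((ghStep a b)^[i] (ghStart a)) ≠ none) : False := by
  induction i with
  | zero =>
    simp only [Function.iterate_zero, id, Nat.zero_add] at h hp
    rw [Function.iterate_succ_apply'] at h
    rcases start_cases a with h0 | ⟨p, h1, h2⟩
    · simp [h0, pos] at hp
    · rw [h2] at h
      obtain ⟨i, -, hi⟩ := step_atBob h.symm
      have h3 := (ha _ _ hi).2
      have h4 := (ha _ _ h1).2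
      rw [h3] at h4
      simp [Fin.succ_ne_zero] at h4
  | succ i ih =>
    rw [show i + 1 + d + 1 = (i + d + 1) + 1 by ring, Function.iterate_succ_apply',
      Function.iterate_succ_apply' _ (i + d + 1)] at h
    rw [Function.iterate_succ_apply'] at hp
    exact ih (step_inj ha hb h hp) (step_pos hp)

theorem result_total {a : Fin (s + 1) → Option (Fin (s + 1))} {b : Fin s → Option (Fin s)}
    (ha : IsPartialMatching a) (hb : IsPartialMatching b) :
    ghResult a b = .exitA ∨ ghResult a b = .exitB := by
  by_contra hcon
  have hlast : pos ((ghStep a b)^[2 * s + 2] (ghStart a)) ≠ none := by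
    unfold ghResult at hcon
    generalize (ghStep a b)^[2 * s + 2] (ghStart a) = σ at hcon
    cases σ <;> simp_all [pos]
  have hall : ∀ k, k ≤ 2 * s + 2 → pos ((ghStep a b)^[2 * s + 2 - k] (ghStart a)) ≠ none := by
    intro k
    induction k with
    | zero => intro _; exact hlast
    | succ k ih =>
      intro hk
      have := ih (by omega)
      rw [show 2 * s + 2 - k = (2 * s + 2 - (k + 1)) + 1 by omega,
        Function.iterate_succ_apply'] at this
      exact step_pos this
  have hall' : ∀ k, k ≤ 2 * s + 2 → pos ((ghStep a b)^[k] (ghStart a)) ≠ none := by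
    intro k hk
    have := hall (2 * s + 2 - k) (by omega)
    rwa [show 2 * s + 2 - (2 * s + 2 - k) = k by omega] at this
  obtain ⟨z, -⟩ := Option.ne_none_iff_exists'.1 hlast
  have : Nonempty (Fin s ⊕ Fin s) := ⟨z⟩
  choose! g hg using fun k hk => Option.ne_none_iff_exists'.1 (hall' k hk)
  have : ∃ x y : Fin (2 * s + 1), x ≠ y ∧ g x = g y := by
    apply Fintype.exists_ne_map_eq_of_card_lt (fun k : Fin (2 * s + 1) => g k)
    simp; omega
  have key : ∀ x y : Fin (2 * s + 1), x < y → g x = g y → False := by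
    intro x y hxy h
    have hx := hg x (by omega)
    have hy := hg y (by omega)
    have hxy' : (x : ℕ) < y := hxy
    have heq := pos_inj (hx.trans (by rw [h, hy])) (by simp [hx])
    refine no_repeat ha hb (y - x - 1) x ?_ (by simp [hx])
    rw [heq]
    congr 2
    omega
  obtain ⟨x, y, hne, h⟩ := this
  rcases lt_or_gt_of_ne hne with h1 | h1
  · exact key x y h1 h
  · exact key y x h1 h.symm

/-- Invariant relating the concrete and the abstract flow. -/
def Inv (a : Fin (s + 1) → Option (Fin (s + 1))) (b : Fin s → Option (Fin s)) :
    GHState s → Prop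
  | .atAlice i => ReflTransGen (Stp (unA a) b) (.A none) (.A (some i))
  | .atBob i => ReflTransGen (Stp (unA a) b) (.A none) (.B i)
  | .exitA => Out (unA a) b false
  | .exitB => Out (unA a) b true

theorem unA_matching {a : Fin (s + 1) → Option (Fin (s + 1))} (ha : IsPartialMatching a) :
    IsPartialMatching (unA a) :=
  conj_matching (hat (Equiv.refl (Fin s))).symm ha

theorem inv_alice {a : Fin (s + 1) → Option (Fin (s + 1))} {b : Fin s → Option (Fin s)}
    (ha : IsPartialMatching a) (hb : IsPartialMatching b) (v : Option (Fin s))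
    (h : ReflTransGen (Stp (unA a) b) (.A none) (.A v)) :
    Inv a b (match a (hat (Equiv.refl _) v) with
      | none => GHState.exitA
      | some k =>
        match toPipe k with
        | none => GHState.exitA
        | some p => GHState.atBob p) := by
  cases hk : a (hat (Equiv.refl _) v) with
  | none => exact ⟨v, h, by simp [unA, hk]⟩
  | some k =>
    induction k using Fin.cases with
    | zero => exact absurd (by simp [unA, hk]) (not_return (unA_matching ha) hb h)
    | succ k =>
      simp only [toPipe_succ]
      exact h.tail (.ab _ _ (by simp [unA, hk]))

theorem inv_iter {a : Fin (s + 1) → Option (Fin (s + 1))} {b : Fin s → Option (Fin s)}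
    (ha : IsPartialMatching a) (hb : IsPartialMatching b) (N : ℕ) :
    Inv a b ((ghStep a b)^[N] (ghStart a)) := by
  induction N with
  | zero =>
    have := inv_alice ha hb none .refl
    simpa [ghStart] using this
  | succ N ih =>
    rw [Function.iterate_succ_apply']
    generalize (ghStep a b)^[N] (ghStart a) = σ at ih
    cases σ with
    | atAlice i =>
      have := inv_alice ha hb (some i) ih
      simpa [ghStep] using this
    | atBob i =>
      cases hk : b i with
      | none => simp only [ghStep, hk]; exact ⟨i, ih, hk⟩
      | some j => simp only [ghStep, hk]; exact ReflTransGen.tail ih (.ba _ _ hk)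
    | exitA => exact ih
    | exitB => exact ih

/-- Abstract reachability yields concrete reachability. -/
def Fwd (e : P ≃ Fin s) (a : Option P → Option (Option P)) (b : P → Option P) : St P → Prop
  | .A none => True
  | .A (some p) => ∃ N, (ghStep (finA e a) (finB e b))^[N] (ghStart (finA e a)) = .atAlice (e p)
  | .B p => ∃ N, (ghStep (finA e a) (finB e b))^[N] (ghStart (finA e a)) = .atBob (e p)

theorem fwd_of_reach (e : P ≃ Fin s) {a : Option P → Option (Option P)} {b : P → Option P}
    {σ : St P} (h : ReflTransGen (Stp a b) (.A none) σ) : Fwd e a b σ := by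
  induction h with
  | refl => trivial
  | tail _ h ih =>
    cases h with
    | ab v p h =>
      cases v with
      | none => exact ⟨0, by simp [ghStart, finA, h, toPipe_succ]⟩
      | some q =>
        obtain ⟨N, hN⟩ := ih
        refine ⟨N + 1, ?_⟩
        rw [Function.iterate_succ_apply', hN]
        simp [ghStep, finA, h, toPipe_succ]
    | ba p q h =>
      obtain ⟨N, hN⟩ := ih
      refine ⟨N + 1, ?_⟩
      rw [Function.iterate_succ_apply', hN]
      simp [ghStep, finB, h]

theorem result_of_iter {a : Fin (s + 1) → Option (Fin (s + 1))} {b : Fin s → Option (Fin s)}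
    (ha : IsPartialMatching a) (hb : IsPartialMatching b) (c : Bool) (N : ℕ)
    (h : (ghStep a b)^[N] (ghStart a) = if c then .exitB else .exitA) :
    ghResult a b = if c then .exitB else .exitA := by
  have hf : ∀ M, (ghStep a b)^[M + N] (ghStart a) = if c then .exitB else .exitA := by
    intro M
    rw [Function.iterate_add_apply, h]
    cases c
    · exact step_exitA a b M
    · exact step_exitB a b M
  have h1 := hf (2 * s + 2)
  rw [Nat.add_comm, Function.iterate_add_apply] at h1
  change (ghStep a b)^[N] (ghResult a b) = _ at h1
  rcases result_total ha hb with h2 | h2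
  · rw [h2, step_exitA] at h1; exact h2.trans h1
  · rw [h2, step_exitB] at h1; exact h2.trans h1

theorem finA_matching (e : P ≃ Fin s) {a : Option P → Option (Option P)}
    (ha : IsPartialMatching a) : IsPartialMatching (finA e a) := conj_matching (hat e) ha

theorem finB_matching (e : P ≃ Fin s) {b : P → Option P}
    (hb : IsPartialMatching b) : IsPartialMatching (finB e b) := conj_matching e hb

theorem result_of_out (e : P ≃ Fin s) {a : Option P → Option (Option P)} {b : P → Option P}
    (ha : IsPartialMatching a) (hb : IsPartialMatching b) {c : Bool} (h : Out a b c) :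
    ghResult (finA e a) (finB e b) = if c then .exitB else .exitA := by
  cases c with
  | false =>
    obtain ⟨v, hv, hv0⟩ := h
    have := fwd_of_reach e hv
    cases v with
    | none =>
      exact result_of_iter (finA_matching e ha) (finB_matching e hb) false 0
        (by simp [ghStart, finA, hv0])
    | some p =>
      obtain ⟨N, hN⟩ := this
      refine result_of_iter (finA_matching e ha) (finB_matching e hb) false (N + 1) ?_
      rw [Function.iterate_succ_apply', hN]
      simp [ghStep, finA, hv0]
  | true =>
    obtain ⟨p, hp, hp0⟩ := h
    obtain ⟨N, hN⟩ := fwd_of_reach e hp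
    refine result_of_iter (finA_matching e ha) (finB_matching e hb) true (N + 1) ?_
    rw [Function.iterate_succ_apply', hN]
    simp [ghStep, finB, hp0]

end fin

/-! ### Games -/

/-- `f` has a deterministic game with `s` pipes. -/
def HasGame (n s : ℕ) (f : (Fin n → Bool) → (Fin n → Bool) → Bool) : Prop :=
  ∃ G : GHGame n s, G.Computes f

theorem game_total {n s : ℕ} (G : GHGame n s) : ∃ f, G.Computes f := by
  refine ⟨fun x y => decide (G.run x y = .exitB), fun x y => ?_⟩
  rcases result_total (G.matchA x) (G.matchB y) with h | h
  · have h' : G.run x y = .exitA := h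
    simp [h']
  · have h' : G.run x y = .exitB := h
    simp [h']

theorem game_out {n s : ℕ} {G : GHGame n s} {f : (Fin n → Bool) → (Fin n → Bool) → Bool}
    (h : G.Computes f) (x y : Fin n → Bool) : Out (unA (G.EA x)) (G.EB y) (f x y) := by
  have h1 := inv_iter (G.matchA x) (G.matchB y) (2 * s + 2)
  have h2 : (ghStep (G.EA x) (G.EB y))^[2 * s + 2] (ghStart (G.EA x)) = _ := h x y
  rw [h2] at h1
  cases hf : f x y <;> rw [hf] at h1 <;> exact h1

theorem mk_game {n s : ℕ} {P : Type} (e : P ≃ Fin s)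
    (a : (Fin n → Bool) → Option P → Option (Option P)) (b : (Fin n → Bool) → P → Option P)
    (ha : ∀ x, IsPartialMatching (a x)) (hb : ∀ y, IsPartialMatching (b y))
    {f : (Fin n → Bool) → (Fin n → Bool) → Bool} (h : ∀ x y, Out (a x) (b y) (f x y)) :
    HasGame n s f :=
  ⟨⟨fun x => finA e (a x), fun y => finB e (b y), fun x => finA_matching e (ha x),
    fun y => finB_matching e (hb y)⟩, fun x y => result_of_out e (ha x) (hb y) (h x y)⟩

theorem HasGame.ite {n s t u : ℕ} {f g h : (Fin n → Bool) → (Fin n → Bool) → Bool}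
    (hf : HasGame n s f) (hg : HasGame n t g) (hh : HasGame n u h) :
    HasGame n (3 * s + t + u + 4) (fun x y => if f x y then g x y else h x y) := by
  obtain ⟨F, hF⟩ := hf
  obtain ⟨G, hG⟩ := hg
  obtain ⟨H, hH⟩ := hh
  have e : CP (Fin s) (Fin t) (Fin u) ≃ Fin (3 * s + t + u + 4) :=
    (cpEquiv _ _ _).trans (Fintype.equivFinOfCardEq (by simp; ring))
  exact mk_game e (fun x => compA (unA (F.EA x)) (unA (G.EA x)) (unA (H.EA x)))
    (fun y => compB (F.EB y) (G.EB y) (H.EB y))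
    (fun x => compA_matching (unA_matching (F.matchA x)) (unA_matching (G.matchA x))
      (unA_matching (H.matchA x)))
    (fun y => compB_matching (F.matchB y) (G.matchB y) (H.matchB y))
    (fun x y => comp_out (unA_matching (F.matchA x)) (F.matchB y) (game_out hF x y)
      (game_out hG x y) (game_out hH x y))

theorem hasGame_false (n : ℕ) : HasGame n 0 (fun _ _ => false) :=
  mk_game (Equiv.refl (Fin 0)) (fun _ _ => none) (fun _ _ => none)
    (fun _ _ _ h => by simp at h) (fun _ _ _ h => by simp at h)
    (fun _ _ => ⟨none, .refl, rfl⟩)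

theorem hasGame_all {n : ℕ} (f : (Fin n → Bool) → (Fin n → Bool) → Bool) :
    ∃ s, HasGame n s f := by
  classical
  refine ⟨_, mk_game (P := (Fin n → Bool) × Bool) (Fintype.equivFin _)
    (fun x v => match v with
      | none => some (some (x, false))
      | some (x', c) => if x' = x ∧ c = false then some none else none)
    (fun y p => if f p.1 y then none else some (p.1, !p.2)) ?_ ?_ ?_⟩
  · rintro x (_ | ⟨x', c⟩) j hj
    · simp only [Option.some.injEq] at hj
      subst hj
      simp
    · simp only at hj
      split_ifs at hj with hc
      simp only [Option.some.injEq] at hj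
      subst hj
      obtain ⟨rfl, rfl⟩ := hc
      simp
  · rintro y ⟨x', c⟩ j hj
    simp only at hj
    split_ifs at hj with hc
    simp only [Option.some.injEq] at hj
    subst hj
    cases c <;> simp [hc]
  · intro x y
    have h1 : ∀ a b, a none = some (some (x, false)) → ReflTransGen (Stp a b) (St.A none)
        (St.B (x, false)) := fun a b h => .single (.ab _ _ h)
    cases hf : f x y with
    | true => exact ⟨(x, false), h1 _ _ rfl, by simp [hf]⟩
    | false =>
      exact ⟨some (x, true), (h1 _ _ rfl).tail (.ba _ _ (by simp [hf])), by simp⟩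

theorem hasGame_true (n : ℕ) : HasGame n 1 (fun _ _ => true) := by
  refine mk_game (Equiv.refl (Fin 1)) (fun _ v => match v with
    | none => some (some 0)
    | some _ => some none) (fun _ _ => none) ?_ (fun _ _ _ h => by simp at h)
    (fun _ _ => ⟨0, .single (.ab _ _ rfl), rfl⟩)
  rintro _ (_ | v) j hj
  · simp only [Option.some.injEq] at hj
    subst hj
    simp
  · simp only [Option.some.injEq] at hj
    subst hj
    simp [Subsingleton.elim v 0]

theorem HasGame.maj {n s : ℕ} {f g h : (Fin n → Bool) → (Fin n → Bool) → Bool}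
    (hf : HasGame n s f) (hg : HasGame n s g) (hh : HasGame n s h) :
    HasGame n (11 * s + 13) (fun x y => if f x y then (if g x y then true else h x y)
      else (if g x y then h x y else false)) := by
  have := hf.ite (hg.ite (hasGame_true n) hh) (hg.ite hh (hasGame_false n))
  rwa [show 3 * s + (3 * s + 1 + s + 4) + (3 * s + s + 0 + 4) + 4 = 11 * s + 13 by ring] at this

/-! ### Randomized protocols -/

section rand
variable {n s : ℕ} {f : (Fin n → Bool) → (Fin n → Bool) → Bool}

theorem mk_rand {ε : ℝ} {R : Type} [Fintype R] (pr : R → ℝ) (h0 : ∀ r, 0 ≤ pr r)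
    (h1 : ∑ r, pr r = 1) (φ : R → (Fin n → Bool) → (Fin n → Bool) → Bool)
    (hφ : ∀ r, HasGame n s (φ r))
    (hc : ∀ x y, 1 - ε ≤ ∑ r, if φ r x y = f x y then pr r else 0) :
    Nonempty (RandGHProtocol n s f ε) := by
  choose G hG using hφ
  let e := (Fintype.equivFin R).symm
  refine ⟨⟨Fintype.card R, fun k => pr (e k), fun k => h0 _, ?_, fun k => G (e k), ?_⟩⟩
  · rw [← h1]; exact Equiv.sum_comp e pr
  · intro x y
    refine (hc x y).trans (le_of_eq ?_)
    rw [← Equiv.sum_comp e]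
    refine Finset.sum_congr rfl fun k _ => ?_
    have := hG (e k) x y
    rw [this]
    cases φ (e k) x y <;> cases f x y <;> simp

theorem rand_data {ε : ℝ} (Q : RandGHProtocol n s f ε) :
    ∃ φ : Fin Q.k → (Fin n → Bool) → (Fin n → Bool) → Bool, (∀ r, HasGame n s (φ r)) ∧
      ∀ x y, 1 - ε ≤ ∑ r, Q.prob r * (if φ r x y = f x y then 1 else 0) := by
  choose φ hφ using fun r => game_total (Q.game r)
  refine ⟨φ, fun r => ⟨_, hφ r⟩, fun x y => (Q.correct x y).trans (le_of_eq ?_)⟩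
  refine Finset.sum_congr rfl fun k _ => ?_
  have := hφ k x y
  rw [this]
  cases φ k x y <;> cases f x y <;> simp

theorem rand_mono {ε ε' : ℝ} (h : ε ≤ ε') (Q : Nonempty (RandGHProtocol n s f ε)) :
    Nonempty (RandGHProtocol n s f ε') := by
  obtain ⟨Q⟩ := Q
  exact ⟨⟨Q.k, Q.prob, Q.prob_nonneg, Q.prob_sum, Q.game, fun x y =>
    le_trans (by linarith) (Q.correct x y)⟩⟩

theorem rand_of_game {ε : ℝ} (hε : 0 ≤ ε) (h : HasGame n s f) :
    Nonempty (RandGHProtocol n s f ε) :=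
  mk_rand (R := Unit) (fun _ => 1) (by simp) (by simp) (fun _ => f) (fun _ => h) (by simpa)

theorem rand_maj {ε : ℝ} (hε : ε ≤ 1) (Q : Nonempty (RandGHProtocol n s f ε)) :
    Nonempty (RandGHProtocol n (11 * s + 13) f (3 * ε ^ 2 - 2 * ε ^ 3)) := by
  obtain ⟨Q⟩ := Q
  obtain ⟨φ, hφ, hc⟩ := rand_data Q
  refine mk_rand (R := Fin Q.k × Fin Q.k × Fin Q.k)
    (fun r => Q.prob r.1 * (Q.prob r.2.1 * Q.prob r.2.2))
    (fun r => mul_nonneg (Q.prob_nonneg _) (mul_nonneg (Q.prob_nonneg _) (Q.prob_nonneg _))) ?_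
    _ (fun r => (hφ r.1).maj (hφ r.2.1) (hφ r.2.2)) ?_
  · simp [Fintype.sum_prod_type, ← Finset.mul_sum, Q.prob_sum]
  · intro x y
    set I : Fin Q.k → ℝ := fun r => if φ r x y = f x y then 1 else 0 with hI
    have hq := hc x y
    set q : ℝ := ∑ r, Q.prob r * I r with hqdef
    have hq1 : q ≤ 1 := by
      rw [← Q.prob_sum]
      refine Finset.sum_le_sum fun r _ => ?_
      have := Q.prob_nonneg r
      simp only [hI]; split_ifs <;> simp [this]
    have key : ∑ r : Fin Q.k × Fin Q.k × Fin Q.k,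
        (if (if φ r.1 x y then (if φ r.2.1 x y then true else φ r.2.2 x y)
          else (if φ r.2.1 x y then φ r.2.2 x y else false)) = f x y then
          Q.prob r.1 * (Q.prob r.2.1 * Q.prob r.2.2) else 0) = 3 * q ^ 2 - 2 * q ^ 3 := by
      have e1 : ∀ r : Fin Q.k × Fin Q.k × Fin Q.k,
        (if (if φ r.1 x y then (if φ r.2.1 x y then true else φ r.2.2 x y)
          else (if φ r.2.1 x y then φ r.2.2 x y else false)) = f x y then
          Q.prob r.1 * (Q.prob r.2.1 * Q.prob r.2.2) else 0) =
          (Q.prob r.1 * I r.1) * ((Q.prob r.2.1 * I r.2.1) * Q.prob r.2.2)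
          + (Q.prob r.1 * I r.1) * (Q.prob r.2.1 * (Q.prob r.2.2 * I r.2.2))
          + Q.prob r.1 * ((Q.prob r.2.1 * I r.2.1) * (Q.prob r.2.2 * I r.2.2))
          - 2 * ((Q.prob r.1 * I r.1) * ((Q.prob r.2.1 * I r.2.1) * (Q.prob r.2.2 * I r.2.2))) := by
        rintro ⟨r1, r2, r3⟩
        simp only [hI]
        cases φ r1 x y <;> cases φ r2 x y <;> cases φ r3 x y <;> cases f x y <;> simp <;> ring
      rw [Finset.sum_congr rfl fun r _ => e1 r]
      simp only [Finset.sum_sub_distrib, Finset.sum_add_distrib, Fintype.sum_prod_type,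
        ← Finset.mul_sum, ← Finset.sum_mul, Q.prob_sum, ← hqdef]
      ring
    rw [key]
    have h2 : 0 ≤ q - (1 - ε) := by linarith
    have h3 : 0 ≤ 1 - ε := by linarith
    have h4 : 0 ≤ q := by linarith
    -- difference of `3 q² - 2 q³` at `q` and at `1 - ε`
    have h5 : 0 ≤ (q - (1 - ε)) * (3 * (q + (1 - ε)) - 2 * (q ^ 2 + q * (1 - ε) + (1 - ε) ^ 2)) := by
      have h6 : 1 - ε ≤ 1 := by linarith
      apply mul_nonneg h2
      nlinarith [mul_nonneg h4 (sub_nonneg.2 hq1), mul_nonneg h3 (sub_nonneg.2 h6),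
        mul_nonneg h4 (sub_nonneg.2 h6), mul_nonneg h3 (sub_nonneg.2 hq1)]
    nlinarith [h5]

theorem phase_one {γ : ℝ} (hγ : 0 ≤ γ) (Q : Nonempty (RandGHProtocol n s f (1 / 2 - γ))) (t : ℕ) :
    ∃ s', s' + 1 ≤ 16 ^ t * (s + 1) ∧
      Nonempty (RandGHProtocol n s' f (1 / 2 - min (1 / 4) ((11 / 8) ^ t * γ))) := by
  induction t with
  | zero =>
    refine ⟨s, by simp, rand_mono ?_ Q⟩
    have := min_le_right (1 / 4 : ℝ) ((11 / 8) ^ 0 * γ)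
    simp only [pow_zero, one_mul] at this ⊢
    linarith
  | succ t ih =>
    obtain ⟨s', hs, hQ⟩ := ih
    have hm0 : 0 ≤ (11 / 8 : ℝ) ^ t * γ := by positivity
    rw [pow_succ (11 / 8 : ℝ) t, mul_comm ((11 / 8 : ℝ) ^ t) (11 / 8), mul_assoc]
    generalize (11 / 8 : ℝ) ^ t * γ = m at hQ hm0
    have h1 : 0 ≤ min (1 / 4) m := le_min (by norm_num) hm0
    have h2 : min (1 / 4) m ≤ 1 / 4 := min_le_left _ _
    have h3 : min (1 / 4) (11 / 8 * m) ≤ 11 / 8 * min (1 / 4) m := by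
      rcases le_total (1 / 4) m with h | h
      · rw [min_eq_left h]; exact (min_le_left _ _).trans (by norm_num)
      · rw [min_eq_right h]; exact min_le_right _ _
    refine ⟨11 * s' + 13, ?_, rand_mono ?_ (rand_maj (by linarith) hQ)⟩
    · rw [pow_succ]; nlinarith
    · generalize min (1 / 4) m = w at *
      nlinarith [mul_nonneg h1 (sub_nonneg.2 h2), mul_nonneg h1 h1,
        mul_nonneg (mul_nonneg h1 h1) (sub_nonneg.2 h2)]

theorem phase_two (Q : Nonempty (RandGHProtocol n s f (1 / 4))) (t : ℕ) :
    ∃ s', s' + 1 ≤ 16 ^ t * (s + 1) ∧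
      Nonempty (RandGHProtocol n s' f ((3 / 4) ^ (2 ^ t) / 3)) := by
  induction t with
  | zero => exact ⟨s, by simp, rand_mono (by norm_num) Q⟩
  | succ t ih =>
    obtain ⟨s', hs, hQ⟩ := ih
    have h1 : 0 ≤ (3 / 4 : ℝ) ^ (2 ^ t) := by positivity
    have h2 : (3 / 4 : ℝ) ^ (2 ^ t) ≤ 1 := pow_le_one₀ (by norm_num) (by norm_num)
    refine ⟨11 * s' + 13, ?_, rand_mono ?_ (rand_maj (by linarith) hQ)⟩
    · rw [pow_succ]; nlinarith
    · rw [pow_succ 2 t, pow_mul]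
      generalize (3 / 4 : ℝ) ^ (2 ^ t) = w at *
      have : 0 ≤ w ^ 3 := by positivity
      nlinarith

end rand

theorem clog_bound {N : ℕ} (hN : 1 ≤ N) : 2 ^ Nat.clog 2 N ≤ 2 * N := by
  rcases hN.eq_or_lt with rfl | h
  · simp
  · have h1 := Nat.pow_pred_clog_lt_self (b := 2) (by norm_num) h
    have h2 : 0 < Nat.clog 2 N := Nat.clog_pos (by norm_num) h
    obtain ⟨k, hk⟩ : ∃ k, Nat.clog 2 N = k + 1 := ⟨_, (Nat.succ_pred_eq_of_pos h2).symm⟩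
    rw [hk] at h1 ⊢
    simp only [Nat.pred_succ] at h1
    rw [pow_succ]
    omega

theorem amplify {n s c d : ℕ} (hn : 1 ≤ n) {f : (Fin n → Bool) → (Fin n → Bool) → Bool}
    (Q : Nonempty (RandGHProtocol n s f (1 / 2 - (n : ℝ) ^ (-(c : ℤ))))) :
    ∃ s', s' + 1 ≤ (64 * n ^ (3 * c + d)) ^ 4 * (s + 1) ∧
      Nonempty (RandGHProtocol n s' f ((2 : ℝ) ^ (-(n ^ d : ℤ)))) := by
  have hn' : (0 : ℝ) < n := by exact_mod_cast hn
  have hnc : 1 ≤ n ^ c := Nat.one_le_pow _ _ hn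
  have hnd : 1 ≤ n ^ d := Nat.one_le_pow _ _ hn
  set t1 := Nat.clog 2 (n ^ c) with ht1
  set t2 := Nat.clog 2 (n ^ d) with ht2
  have b1 : 2 ^ t1 ≤ 2 * n ^ c := clog_bound hnc
  have b2 : 2 ^ t2 ≤ 2 * n ^ d := clog_bound hnd
  have l1 : n ^ c ≤ 2 ^ t1 := Nat.le_pow_clog (by norm_num) _
  have l2 : n ^ d ≤ 2 ^ t2 := Nat.le_pow_clog (by norm_num) _
  obtain ⟨s1, hs1, Q1⟩ := phase_one (by positivity) Q (3 * t1)
  have hbig : (1 : ℝ) / 4 ≤ (11 / 8) ^ (3 * t1) * (n : ℝ) ^ (-(c : ℤ)) := by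
    have h1 : (n : ℝ) ^ c ≤ (11 / 8) ^ (3 * t1) := by
      calc (n : ℝ) ^ c ≤ 2 ^ t1 := by exact_mod_cast l1
        _ ≤ ((11 / 8) ^ 3) ^ t1 := pow_le_pow_left₀ (by norm_num) (by norm_num) _
        _ = _ := by rw [pow_mul]
    rw [zpow_neg, zpow_natCast, ← div_eq_mul_inv]
    have : 1 ≤ (11 / 8 : ℝ) ^ (3 * t1) / (n : ℝ) ^ c := (one_le_div (by positivity)).2 h1
    linarith
  rw [min_eq_left hbig] at Q1
  obtain ⟨s2, hs2, Q2⟩ := phase_two (rand_mono (by norm_num) Q1) (t2 + 2)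
  refine ⟨s2, ?_, rand_mono ?_ Q2⟩
  · calc s2 + 1 ≤ 16 ^ (t2 + 2) * (16 ^ (3 * t1) * (s + 1)) :=
          hs2.trans (Nat.mul_le_mul_left _ hs1)
      _ = (4 * 2 ^ t2 * (2 ^ t1) ^ 3) ^ 4 * (s + 1) := by
          rw [show (16 : ℕ) = 2 ^ 4 by norm_num, ← pow_mul, ← pow_mul]; ring
      _ ≤ (4 * (2 * n ^ d) * (2 * n ^ c) ^ 3) ^ 4 * (s + 1) := by gcongr
      _ = _ := by ring
  · have h3 : (3 / 4 : ℝ) ^ (2 ^ (t2 + 2)) ≤ (1 / 2) ^ (n ^ d) := by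
      calc (3 / 4 : ℝ) ^ (2 ^ (t2 + 2)) = ((3 / 4) ^ 4) ^ (2 ^ t2) := by
            rw [← pow_mul]; congr 1; ring
        _ ≤ (1 / 2) ^ (2 ^ t2) := pow_le_pow_left₀ (by norm_num) (by norm_num) _
        _ ≤ _ := pow_le_pow_of_le_one (by norm_num) (by norm_num) l2
    have h4 : (2 : ℝ) ^ (-(n ^ d : ℤ)) = (1 / 2) ^ (n ^ d) := by
      rw [zpow_neg, one_div, inv_pow]
      congr 1
    rw [h4]
    have : (0 : ℝ) ≤ (3 / 4) ^ (2 ^ (t2 + 2)) := by positivity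
    linarith

end GHAmp

/-- Error amplification: if the randomized garden-hose complexity of the family
`f_n` with error `ε(n) = 1/2 - n^(-c)` is polynomially bounded, then for any
`d ≥ 1` the randomized garden-hose complexity with error `2 ^ (-n ^ d)` is
polynomially bounded as well. -/
theorem ghr_amplification (c d : ℕ) (hc : 1 ≤ c) (hd : 1 ≤ d)
    (f : ∀ n : ℕ, (Fin n → Bool) → (Fin n → Bool) → Bool)
    (p : Polynomial ℕ)
    (hp : ∀ n : ℕ, GHr ((1 : ℝ) / 2 - (n : ℝ) ^ (-(c : ℤ))) (f n) ≤ p.eval n) :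
    ∃ q : Polynomial ℕ, ∀ n : ℕ,
      (∃ s : ℕ, s ≤ q.eval n ∧
        Nonempty (RandGHProtocol n s (f n) ((2 : ℝ) ^ (-(n ^ d : ℤ))))) ∧
      GHr ((2 : ℝ) ^ (-(n ^ d : ℤ))) (f n) ≤ q.eval n := by
  obtain ⟨s0, h0⟩ := GHAmp.hasGame_all (f 0)
  obtain ⟨s1, h1⟩ := GHAmp.hasGame_all (f 1)
  refine ⟨Polynomial.C s0 + Polynomial.C s1 +
    (Polynomial.C 64 * Polynomial.X ^ (3 * c + d)) ^ 4 * (p + 1), fun n => ?_⟩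
  suffices h : ∃ s : ℕ, s ≤ (Polynomial.C s0 + Polynomial.C s1 +
      (Polynomial.C 64 * Polynomial.X ^ (3 * c + d)) ^ 4 * (p + 1)).eval n ∧
      Nonempty (RandGHProtocol n s (f n) ((2 : ℝ) ^ (-(n ^ d : ℤ)))) by
    refine ⟨h, ?_⟩
    obtain ⟨s, hs, hQ⟩ := h
    exact (Nat.sInf_le hQ).trans hs
  have heval : (Polynomial.C s0 + Polynomial.C s1 +
      (Polynomial.C 64 * Polynomial.X ^ (3 * c + d)) ^ 4 * (p + 1)).eval n =
      s0 + s1 + (64 * n ^ (3 * c + d)) ^ 4 * (p.eval n + 1) := by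
    simp only [Polynomial.eval_add, Polynomial.eval_mul, Polynomial.eval_pow, Polynomial.eval_C,
      Polynomial.eval_X, Polynomial.eval_one]
  rw [heval]
  have hpos : (0 : ℝ) ≤ (2 : ℝ) ^ (-(n ^ d : ℤ)) := by positivity
  rcases Nat.lt_or_ge n 2 with hn | hn
  · interval_cases n
    · exact ⟨s0, by omega, GHAmp.rand_of_game hpos h0⟩
    · exact ⟨s1, by omega, GHAmp.rand_of_game hpos h1⟩
  · have hε : (0 : ℝ) ≤ 1 / 2 - (n : ℝ) ^ (-(c : ℤ)) := by
      have h2 : (2 : ℝ) ≤ (n : ℝ) ^ c := by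
        calc (2 : ℝ) ≤ n := by exact_mod_cast hn
          _ ≤ (n : ℝ) ^ c := le_self_pow₀ (by exact_mod_cast (by omega : 1 ≤ n)) (by omega)
      rw [zpow_neg, zpow_natCast, sub_nonneg, one_div]
      exact inv_anti₀ (by norm_num) h2
    obtain ⟨s, hs⟩ := GHAmp.hasGame_all (f n)
    have hne : {s : ℕ | Nonempty (RandGHProtocol n s (f n)
        ((1 : ℝ) / 2 - (n : ℝ) ^ (-(c : ℤ))))}.Nonempty := ⟨s, GHAmp.rand_of_game hε hs⟩
    have hmem := Nat.sInf_mem hne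
    obtain ⟨s', hs', hQ⟩ := GHAmp.amplify (d := d) (by omega : 1 ≤ n) hmem
    refine ⟨s', ?_, hQ⟩
    have hle : s' + 1 ≤ (64 * n ^ (3 * c + d)) ^ 4 * (p.eval n + 1) :=
      hs'.trans (Nat.mul_le_mul_left _ (Nat.add_le_add_right (hp n) 1))
    omega
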